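/- Let I = B(M,N) ⊆ S = K[x_1, …, x_n] with Borel generators M = x_a·x_b and N = x_c·x_d, c < a ≤ b < d, let G₂ = { T_u T_v − T_{u'} T_{v'} : u·v = u'·v' and u, v ≻_mrlex v' } marked at T_u T_v, and let μ be a monomial such that the fiber graph Γ_μ(I) with respect to G₂ is nonempty, with unique sink T = T_{p_1}⋯T_{p_r}, where p_1 ⪰_mrlex … ⪰_mrlex p_r. Let k < l, and write p_k = x_i x_j (i ≤ j) and p_l = x_{i'} x_{j'} (i' ≤ j'). (a) If p_k and p_l are both in B_M or both in B_N, then i ≤ i' and j ≤ j'. (b) If p_k ∈ B_N and p_l ∈ B_M, then i ≤ i'. -/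

import Mathlib

/-- A marked binomial: the difference of two monomials (given by exponent vectors),
with `head` chosen as the marked term. -/
structure MarkedBinomial (V : Type*) where
  head : V →₀ ℕ
  tail : V →₀ ℕ

/-- The polynomial associated to a marked binomial. -/
noncomputable def MarkedBinomial.toPoly {V : Type*} (K : Type*) [Field K]
    (g : MarkedBinomial V) : MvPolynomial V K :=
  MvPolynomial.monomial g.head 1 - MvPolynomial.monomial g.tail 1

/-- Transport a marked binomial along a map of variables. -/
noncomputable def MarkedBinomial.map {V W : Type*} (f : V → W) (g : MarkedBinomial V) :
    MarkedBinomial W :=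
  ⟨Finsupp.mapDomain f g.head, Finsupp.mapDomain f g.tail⟩

/-- A monomial order on the exponent vectors `V →₀ ℕ`: a strict total order, compatible
with addition, for which `1` (the zero exponent vector) is the smallest monomial. -/
structure MonomialOrd (V : Type*) where
  gt : (V →₀ ℕ) → (V →₀ ℕ) → Prop
  irrefl : ∀ m, ¬ gt m m
  trans : ∀ {m₁ m₂ m₃}, gt m₁ m₂ → gt m₂ m₃ → gt m₁ m₃
  total : ∀ m₁ m₂, m₁ ≠ m₂ → gt m₁ m₂ ∨ gt m₂ m₁
  add_right : ∀ {m₁ m₂} (m₃), gt m₁ m₂ → gt (m₁ + m₃) (m₂ + m₃)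
  gt_zero : ∀ m, m ≠ 0 → gt m 0

/-- `m` is the initial (leading) exponent of `f` with respect to the strict order `gt`. -/
def IsInitialTerm {V K : Type*} [Field K] (gt : (V →₀ ℕ) → (V →₀ ℕ) → Prop)
    (f : MvPolynomial V K) (m : V →₀ ℕ) : Prop :=
  m ∈ f.support ∧ ∀ m' ∈ f.support, m' ≠ m → gt m m'

/-- A set `G` of marked binomials is a Gröbner basis of the ideal `J` with respect to the
order `gt`, with the marked terms as initial terms: `G ⊆ J`, each marked term is the
initial term of its binomial, and the marked terms generate the initial ideal of `J`. -/
def IsMarkedGB {V K : Type*} [Field K] (gt : (V →₀ ℕ) → (V →₀ ℕ) → Prop)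
    (G : Set (MarkedBinomial V)) (J : Ideal (MvPolynomial V K)) : Prop :=
  (∀ g ∈ G, g.toPoly K ∈ J) ∧ (∀ g ∈ G, gt g.head g.tail) ∧
    Ideal.span ((fun g => (MvPolynomial.monomial g.head (1 : K) : MvPolynomial V K)) '' G) =
      Ideal.span {p : MvPolynomial V K |
        ∃ f ∈ J, f ≠ 0 ∧ ∃ m, IsInitialTerm gt f m ∧ p = MvPolynomial.monomial m (1 : K)}

/-- One-step reduction of a monomial (exponent vector) with respect to a collection of
marked binomials: replace an occurrence of a marked term by the corresponding tail. -/
def Reduces {V : Type*} (G : Set (MarkedBinomial V)) (m m' : V →₀ ℕ) : Prop :=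
  ∃ g ∈ G, g.head ≤ m ∧ m' = m - g.head + g.tail

/-- One-step reduction of a polynomial with respect to a collection of marked binomials. -/
noncomputable def PolyReduces {V K : Type*} [Field K] (G : Set (MarkedBinomial V))
    (f f' : MvPolynomial V K) : Prop :=
  ∃ g ∈ G, ∃ m ∈ f.support, g.head ≤ m ∧
    f' = f - MvPolynomial.monomial (m - g.head) (MvPolynomial.coeff m f) * g.toPoly K

/-- The image monomial (in the `W`-variables) of a monomial `T` in the `V`-variables under
the monomial map sending the variable `v` to the monomial with exponent vector `u v`. -/
noncomputable def fiberMap {V W : Type*} (u : V → (W →₀ ℕ)) (T : V →₀ ℕ) : W →₀ ℕ :=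
  T.sum fun v e => e • u v

/-- `T` is a sink of the fiber graph over the multidegree `μ` (with respect to the
marked binomials `G` and the monomial map determined by `u`): it lies in the fiber and
has no outgoing edge inside the fiber. -/
noncomputable def IsFiberSink {V W : Type*} (G : Set (MarkedBinomial V)) (u : V → (W →₀ ℕ))
    (μ : W →₀ ℕ) (T : V →₀ ℕ) : Prop :=
  fiberMap u T = μ ∧ ∀ T', Reduces G T T' → fiberMap u T' ≠ μ

/-- `I` is a monomial ideal. -/
def IsMonomialIdeal {n : ℕ} {K : Type*} [Field K] (I : Ideal (MvPolynomial (Fin n) K)) : Prop :=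
  ∃ M : Set (Fin n →₀ ℕ), I = Ideal.span ((fun m => (MvPolynomial.monomial m (1 : K))) '' M)

/-- `I` is a strongly stable (Borel) ideal: a monomial ideal such that whenever `x_i`
divides a monomial `m ∈ I` and `j < i`, also `x_j · m / x_i ∈ I`. -/
def StronglyStable {n : ℕ} {K : Type*} [Field K] (I : Ideal (MvPolynomial (Fin n) K)) : Prop :=
  IsMonomialIdeal I ∧ ∀ m : Fin n →₀ ℕ, MvPolynomial.monomial m (1 : K) ∈ I →
    ∀ i j : Fin n, j < i → m i ≠ 0 →
      MvPolynomial.monomial (m - Finsupp.single i 1 + Finsupp.single j 1) (1 : K) ∈ I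

/-- The smallest strongly stable ideal containing the given monomials. -/
noncomputable def smallestStronglyStable {n : ℕ} (K : Type*) [Field K]
    (Ms : Set (Fin n →₀ ℕ)) : Ideal (MvPolynomial (Fin n) K) :=
  sInf {I | StronglyStable I ∧ ∀ m ∈ Ms, MvPolynomial.monomial m (1 : K) ∈ I}

/-- The minimal monomial generators of an ideal generated in the single degree `d`:
the degree-`d` monomials lying in `I`. -/
def MinGens {n : ℕ} {K : Type*} [Field K] (I : Ideal (MvPolynomial (Fin n) K)) (d : ℕ) :
    Set (Fin n →₀ ℕ) :=
  {m | (m.sum fun _ e => e) = d ∧ MvPolynomial.monomial m (1 : K) ∈ I}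

/-- `u ≻_rlex v` (reverse lexicographic, `x_1 > … > x_n`, for exponent vectors of equal
total degree): at the largest index where they differ, `u` has the smaller exponent. -/
def RlexGt {n : ℕ} (u v : Fin n →₀ ℕ) : Prop :=
  ∃ k : Fin n, u k < v k ∧ ∀ l : Fin n, k < l → u l = v l

/-- The (degree-)reverse lexicographic order on monomials of `K[V]` induced by the strict
variable order `vgt` (where `vgt k l` means the variable `k` is greater than `l`). -/
def VarRevlexGt {V : Type*} (vgt : V → V → Prop) (m m' : V →₀ ℕ) : Prop :=
  (m.sum fun _ e => e) > (m'.sum fun _ e => e) ∨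
    ((m.sum fun _ e => e) = (m'.sum fun _ e => e) ∧
      ∃ k, m k < m' k ∧ ∀ l, vgt k l → m l = m' l)

/-- The minimal monomial generators of the strongly stable ideal `B(x_a x_b)` (`a ≤ b`):
the monomials `x_i x_j` with `i ≤ j`, `i ≤ a`, `j ≤ b`. -/
def BM {n : ℕ} (a b : Fin n) : Set (Fin n →₀ ℕ) :=
  {m | ∃ i j : Fin n, i ≤ j ∧ i ≤ a ∧ j ≤ b ∧ m = Finsupp.single i 1 + Finsupp.single j 1}

/-- The minimal monomial generators of `B(x_c x_d)` not in `B(x_a x_b)` (for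
`c < a ≤ b < d`): the monomials `x_i x_j` with `i ≤ c` and `b < j ≤ d`. -/
def BN {n : ℕ} (b c d : Fin n) : Set (Fin n →₀ ℕ) :=
  {m | ∃ i j : Fin n, i ≤ c ∧ b < j ∧ j ≤ d ∧ m = Finsupp.single i 1 + Finsupp.single j 1}

/-- `u ≻_mrlex v`: every element of `B_N` is greater than every element of `B_M`, and
within `B_M` (resp. `B_N`) the order agrees with `≻_rlex`. -/
def MrlexGt {n : ℕ} (a b c d : Fin n) (u v : Fin n →₀ ℕ) : Prop :=
  (u ∈ BN b c d ∧ v ∈ BM a b) ∨ (u ∈ BM a b ∧ v ∈ BM a b ∧ RlexGt u v) ∨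
    (u ∈ BN b c d ∧ v ∈ BN b c d ∧ RlexGt u v)

/-- The collection `G₁` of marked binomials `T_u T_v − T_{u'} T_{v'}` with `u v = u' v'`
and `u, v ≻_rlex v'`, marked at `T_u T_v`. -/
def G1 {n : ℕ} (a b c d : Fin n) : Set (MarkedBinomial ↥(BM a b ∪ BN b c d)) :=
  {g | ∃ u v u' v' : ↥(BM a b ∪ BN b c d),
    (u : Fin n →₀ ℕ) + (v : Fin n →₀ ℕ) = (u' : Fin n →₀ ℕ) + (v' : Fin n →₀ ℕ) ∧
    RlexGt (u : Fin n →₀ ℕ) (v' : Fin n →₀ ℕ) ∧ RlexGt (v : Fin n →₀ ℕ) (v' : Fin n →₀ ℕ) ∧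
    g.head = Finsupp.single u 1 + Finsupp.single v 1 ∧
    g.tail = Finsupp.single u' 1 + Finsupp.single v' 1}

/-- The collection `G₂` of marked binomials `T_u T_v − T_{u'} T_{v'}` with `u v = u' v'`
and `u, v ≻_mrlex v'`, marked at `T_u T_v`. -/
def G2 {n : ℕ} (a b c d : Fin n) : Set (MarkedBinomial ↥(BM a b ∪ BN b c d)) :=
  {g | ∃ u v u' v' : ↥(BM a b ∪ BN b c d),
    (u : Fin n →₀ ℕ) + (v : Fin n →₀ ℕ) = (u' : Fin n →₀ ℕ) + (v' : Fin n →₀ ℕ) ∧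
    MrlexGt a b c d (u : Fin n →₀ ℕ) (v' : Fin n →₀ ℕ) ∧
    MrlexGt a b c d (v : Fin n →₀ ℕ) (v' : Fin n →₀ ℕ) ∧
    g.head = Finsupp.single u 1 + Finsupp.single v 1 ∧
    g.tail = Finsupp.single u' 1 + Finsupp.single v' 1}

/-- `w` is the smallest (with respect to the variable order induced by `≻_rlex`) variable
factor of the monomial `T` whose underlying monomial lies in `S`. -/
def IsLeastFactorIn {n : ℕ} {V : Set (Fin n →₀ ℕ)} (S : Set (Fin n →₀ ℕ))
    (T : ↥V →₀ ℕ) (w : ↥V) : Prop :=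
  w ∈ T.support ∧ (w : Fin n →₀ ℕ) ∈ S ∧
    ∀ v ∈ T.support, (v : Fin n →₀ ℕ) ∈ S →
      v = w ∨ RlexGt (v : Fin n →₀ ℕ) (w : Fin n →₀ ℕ)

/-- `m` is the `≻_rlex`-smallest element of `S` dividing `μ`. -/
def IsLeastDivisorIn {n : ℕ} (S : Set (Fin n →₀ ℕ)) (μ m : Fin n →₀ ℕ) : Prop :=
  m ∈ S ∧ m ≤ μ ∧ ∀ m' ∈ S, m' ≤ μ → m' = m ∨ RlexGt m' m

theorem rlexGt_single_add {n : ℕ} {s t : Fin n} (h : s < t) (m : Fin n →₀ ℕ) :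
    RlexGt (Finsupp.single s 1 + m) (Finsupp.single t 1 + m) := by
  refine ⟨t, ?_, fun l hl => ?_⟩
  · simp [h.ne]
  · simp [(h.trans hl).ne, hl.ne]

theorem RlexGt.irrefl {n : ℕ} (u : Fin n →₀ ℕ) : ¬ RlexGt u u := fun ⟨_, h, _⟩ => lt_irrefl _ h

theorem RlexGt.asymm {n : ℕ} {u v : Fin n →₀ ℕ} (huv : RlexGt u v) : ¬ RlexGt v u := by
  obtain ⟨k, hk, hk'⟩ := huv
  rintro ⟨l, hl, hl'⟩
  rcases lt_trichotomy k l with h | rfl | h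
  · exact hl.ne' (hk' l h)
  · exact lt_asymm hk hl
  · exact hk.ne' (hl' k h)

theorem rlexGt_pair_of_lt {n : ℕ} {i j i' j' : Fin n} (hij : i ≤ j) (hij' : i' ≤ j')
    (h : j < j') :
    RlexGt (Finsupp.single i 1 + Finsupp.single j 1 : Fin n →₀ ℕ)
      (Finsupp.single i' 1 + Finsupp.single j' 1) := by
  refine ⟨j', ?_, fun l hl => ?_⟩
  · simp [Finsupp.single_apply, h.ne, (hij.trans_lt h).ne]
  · simp [(h.trans hl).ne, hl.ne, (hij.trans_lt (h.trans hl)).ne,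
      (hij'.trans_lt hl).ne]

theorem lt_or_eq_and_lt_of_rlexGt_pair {n : ℕ} {i j i' j' : Fin n} (hij : i ≤ j)
    (hij' : i' ≤ j')
    (h : RlexGt (Finsupp.single i 1 + Finsupp.single j 1 : Fin n →₀ ℕ)
      (Finsupp.single i' 1 + Finsupp.single j' 1)) :
    j < j' ∨ j = j' ∧ i < i' := by
  rcases lt_trichotomy j j' with hj | rfl | hj
  · exact Or.inl hj
  · refine Or.inr ⟨rfl, ?_⟩
    rcases lt_trichotomy i i' with hi | rfl | hi
    · exact hi
    · exact (RlexGt.irrefl _ h).elim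
    · exact (h.asymm (rlexGt_single_add hi _)).elim
  · exact (h.asymm (rlexGt_pair_of_lt hij' hij hj)).elim

theorem single_add_single_inj_of_le {n : ℕ} {i j i' j' : Fin n} (hij : i ≤ j) (hij' : i' ≤ j')
    (h : (Finsupp.single i 1 + Finsupp.single j 1 : Fin n →₀ ℕ) =
      Finsupp.single i' 1 + Finsupp.single j' 1) : i = i' ∧ j = j' := by
  rcases lt_trichotomy j j' with hj | rfl | hj
  · exact (RlexGt.irrefl _ (h ▸ rlexGt_pair_of_lt hij hij' hj)).elim
  · exact ⟨Finsupp.single_left_injective one_ne_zero (add_right_cancel h), rfl⟩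
  · exact (RlexGt.irrefl _ (h ▸ rlexGt_pair_of_lt hij' hij hj)).elim

theorem pair_mem_BM_iff {n : ℕ} {a b i j : Fin n} (hij : i ≤ j) :
    (Finsupp.single i 1 + Finsupp.single j 1 : Fin n →₀ ℕ) ∈ BM a b ↔ i ≤ a ∧ j ≤ b := by
  refine ⟨?_, fun ⟨hi, hj⟩ => ⟨i, j, hij, hi, hj, rfl⟩⟩
  rintro ⟨s, t, hst, hs, ht, h⟩
  obtain ⟨rfl, rfl⟩ := single_add_single_inj_of_le hij hst h
  exact ⟨hs, ht⟩

theorem pair_mem_BN_iff {n : ℕ} {b c d i j : Fin n} (hcb : c ≤ b) (hij : i ≤ j) :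
    (Finsupp.single i 1 + Finsupp.single j 1 : Fin n →₀ ℕ) ∈ BN b c d ↔
      i ≤ c ∧ b < j ∧ j ≤ d := by
  refine ⟨?_, fun ⟨hi, hj, hj'⟩ => ⟨i, j, hi, hj, hj', rfl⟩⟩
  rintro ⟨s, t, hs, ht, ht', h⟩
  obtain ⟨rfl, rfl⟩ := single_add_single_inj_of_le hij ((hs.trans hcb).trans ht.le) h
  exact ⟨hs, ht, ht'⟩

theorem disjoint_BM_BN {n : ℕ} {a b c d : Fin n} (hcb : c ≤ b) :
    Disjoint (BM a b) (BN b c d) := by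
  rw [Set.disjoint_left]
  rintro _ ⟨i, j, hij, -, hj, rfl⟩ h
  exact ((pair_mem_BN_iff hcb hij).1 h).2.1.not_ge hj

theorem fiberMap_add {V W : Type*} (u : V → (W →₀ ℕ)) (S T : V →₀ ℕ) :
    fiberMap u (S + T) = fiberMap u S + fiberMap u T := by
  classical
  exact Finsupp.sum_add_index' (fun _ => zero_smul _ _) fun _ _ _ => add_smul _ _ _

theorem fiberMap_single_one {V W : Type*} (u : V → (W →₀ ℕ)) (v : V) :
    fiberMap u (Finsupp.single v 1) = u v := by
  simp [fiberMap]

theorem Finsupp.single_add_single_le_sum {V ι : Type*} [Fintype ι] (p : ι → V) {k l : ι}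
    (hkl : k ≠ l) :
    (Finsupp.single (p k) 1 + Finsupp.single (p l) 1 : V →₀ ℕ) ≤
      ∑ s, Finsupp.single (p s) 1 := by
  classical
  rw [← Finset.sum_pair (f := fun s => (Finsupp.single (p s) 1 : V →₀ ℕ)) hkl]
  exact Finset.sum_le_sum_of_subset (Finset.subset_univ _)

/-- A sink of the fiber graph contains no product of two variables that is the head of an element
of `G2`. -/
theorem IsFiberSink.not_mrlexGt_and {n : ℕ} {a b c d : Fin n} {μ : Fin n →₀ ℕ}
    {T : ↥(BM a b ∪ BN b c d) →₀ ℕ}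
    (hsink : IsFiberSink (G2 a b c d) (fun w : ↥(BM a b ∪ BN b c d) => (w : Fin n →₀ ℕ)) μ T)
    {u v : ↥(BM a b ∪ BN b c d)} (hle : Finsupp.single u 1 + Finsupp.single v 1 ≤ T)
    {u' v' : Fin n →₀ ℕ} (hu' : u' ∈ BM a b ∪ BN b c d) (hv' : v' ∈ BM a b ∪ BN b c d)
    (huv : (u : Fin n →₀ ℕ) + v = u' + v') :
    ¬ (MrlexGt a b c d u v' ∧ MrlexGt a b c d v v') := by
  rintro ⟨hu, hv⟩
  refine hsink.2 _ ⟨⟨Finsupp.single u 1 + Finsupp.single v 1,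
    Finsupp.single ⟨u', hu'⟩ 1 + Finsupp.single ⟨v', hv'⟩ 1⟩,
    ⟨u, v, ⟨u', hu'⟩, ⟨v', hv'⟩, huv, hu, hv, rfl, rfl⟩, hle, rfl⟩ ?_
  have hT := hsink.1
  rw [← tsub_add_cancel_of_le hle] at hT
  simpa only [fiberMap_add, fiberMap_single_one, huv] using hT

/-- Let `I = B(x_a x_b, x_c x_d)` with `c < a ≤ b < d`, and let
`T = T_{p_1} ⋯ T_{p_r}` (with `p_1 ⪰_mrlex … ⪰_mrlex p_r`) be the sink of a nonempty
fiber graph `Γ_μ(I)` with respect to `G₂`. Write `p_k = x_i x_j` (`i ≤ j`) and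
`p_l = x_{i'} x_{j'}` (`i' ≤ j'`) with `k < l`. (a) If `p_k, p_l` are both in `B_M` or
both in `B_N`, then `i ≤ i'` and `j ≤ j'`. (b) If `p_k ∈ B_N` and `p_l ∈ B_M`, then
`i ≤ i'`. -/
theorem tail_comparison_mixed_rlex {n : ℕ} (a b c d : Fin n)
    (h1 : c < a) (h2 : a ≤ b) (h3 : b < d) (μ : Fin n →₀ ℕ) (r : ℕ)
    (p : Fin r → ↥(BM a b ∪ BN b c d))
    (hsorted : ∀ k l : Fin r, k ≤ l →
      p k = p l ∨ MrlexGt a b c d ((p k : _) : Fin n →₀ ℕ) ((p l : _) : Fin n →₀ ℕ))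
    (T : ↥(BM a b ∪ BN b c d) →₀ ℕ)
    (hTdef : T = ∑ k : Fin r, Finsupp.single (p k) 1)
    (hsink : IsFiberSink (G2 a b c d) (fun w : ↥(BM a b ∪ BN b c d) => (w : Fin n →₀ ℕ)) μ T)
    (k l : Fin r) (hkl : k < l)
    (i j i' j' : Fin n) (hij : i ≤ j) (hij' : i' ≤ j')
    (hpk : ((p k : _) : Fin n →₀ ℕ) = Finsupp.single i 1 + Finsupp.single j 1)
    (hpl : ((p l : _) : Fin n →₀ ℕ) = Finsupp.single i' 1 + Finsupp.single j' 1) :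
    (((((p k : _) : Fin n →₀ ℕ) ∈ BM a b ∧ ((p l : _) : Fin n →₀ ℕ) ∈ BM a b) ∨
      (((p k : _) : Fin n →₀ ℕ) ∈ BN b c d ∧ ((p l : _) : Fin n →₀ ℕ) ∈ BN b c d)) →
      i ≤ i' ∧ j ≤ j') ∧
    ((((p k : _) : Fin n →₀ ℕ) ∈ BN b c d ∧ ((p l : _) : Fin n →₀ ℕ) ∈ BM a b) →
      i ≤ i') := by
  have hcb : c ≤ b := h1.le.trans h2
  have hno {u' v' : Fin n →₀ ℕ} (hu' : u' ∈ BM a b ∪ BN b c d) (hv' : v' ∈ BM a b ∪ BN b c d) :=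
    hsink.not_mrlexGt_and
      (hTdef ▸ Finsupp.single_add_single_le_sum p hkl.ne) hu' hv'
  have hswap : (Finsupp.single i 1 + Finsupp.single j 1 : Fin n →₀ ℕ) +
      (Finsupp.single i' 1 + Finsupp.single j' 1) =
      (Finsupp.single i' 1 + Finsupp.single j 1) + (Finsupp.single i 1 + Finsupp.single j' 1) := by
    abel
  have hs := hsorted k l hkl.le
  rw [← Subtype.coe_inj] at hs
  rw [hpk, hpl] at hs hno ⊢
  have hrlex (hi : i' < i) : RlexGt (Finsupp.single i' 1 + Finsupp.single j' 1 : Fin n →₀ ℕ)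
      (Finsupp.single i 1 + Finsupp.single j' 1) := rlexGt_single_add hi _
  refine ⟨fun hmem => ?_, fun ⟨hk, hl⟩ => ?_⟩
  · rcases hs with heq | hgt
    · obtain ⟨rfl, rfl⟩ := single_add_single_inj_of_le hij hij' heq
      exact ⟨le_rfl, le_rfl⟩
    have hdisj := Set.disjoint_left.1 (disjoint_BM_BN (a := a) (d := d) hcb)
    have hgt' : RlexGt (Finsupp.single i 1 + Finsupp.single j 1 : Fin n →₀ ℕ)
        (Finsupp.single i' 1 + Finsupp.single j' 1) := by
      rcases hgt with ⟨hk, hl⟩ | ⟨-, -, h⟩ | ⟨-, -, h⟩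
      · rcases hmem with ⟨hk', -⟩ | ⟨-, hl'⟩
        · exact (hdisj hk' hk).elim
        · exact (hdisj hl hl').elim
      · exact h
      · exact h
    rcases lt_or_eq_and_lt_of_rlexGt_pair hij hij' hgt' with hj | ⟨hj, hi⟩
    · refine ⟨le_of_not_gt fun hi => ?_, hj.le⟩
      have hk' := rlexGt_pair_of_lt hij (hij.trans hj.le) hj
      rcases hmem with ⟨hk, hl⟩ | ⟨hk, hl⟩
      · have hk₀ := (pair_mem_BM_iff hij).1 hk
        have hl₀ := (pair_mem_BM_iff hij').1 hl
        have hv' := (pair_mem_BM_iff (hij.trans hj.le)).2 ⟨hk₀.1, hl₀.2⟩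
        exact hno (Or.inl ((pair_mem_BM_iff (hi.le.trans hij)).2 ⟨hl₀.1, hk₀.2⟩))
          (Or.inl hv') hswap
          ⟨Or.inr (Or.inl ⟨hk, hv', hk'⟩), Or.inr (Or.inl ⟨hl, hv', hrlex hi⟩)⟩
      · have hk₀ := (pair_mem_BN_iff hcb hij).1 hk
        have hl₀ := (pair_mem_BN_iff hcb hij').1 hl
        have hv' := (pair_mem_BN_iff hcb (hij.trans hj.le)).2 ⟨hk₀.1, hl₀.2⟩
        exact hno (Or.inr ((pair_mem_BN_iff hcb (hi.le.trans hij)).2 ⟨hl₀.1, hk₀.2⟩))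
          (Or.inr hv') hswap
          ⟨Or.inr (Or.inr ⟨hk, hv', hk'⟩), Or.inr (Or.inr ⟨hl, hv', hrlex hi⟩)⟩
    · exact ⟨hi.le, hj.le⟩
  · refine le_of_not_gt fun hi => ?_
    have hk₀ := (pair_mem_BN_iff hcb hij).1 hk
    have hl₀ := (pair_mem_BM_iff hij').1 hl
    have hv' : (Finsupp.single i 1 + Finsupp.single j' 1 : Fin n →₀ ℕ) ∈ BM a b := by
      rcases le_total i j' with h | h
      · exact (pair_mem_BM_iff h).2 ⟨hk₀.1.trans h1.le, hl₀.2⟩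
      · rw [add_comm]
        exact (pair_mem_BM_iff h).2 ⟨h.trans (hk₀.1.trans h1.le), hk₀.1.trans hcb⟩
    exact hno (Or.inr ((pair_mem_BN_iff hcb (hi.le.trans hij)).2 ⟨hi.le.trans hk₀.1, hk₀.2⟩))
      (Or.inl hv') hswap ⟨Or.inl ⟨hk, hv'⟩, Or.inr (Or.inl ⟨hl, hv', hrlex hi⟩)⟩
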